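/- arXiv:1401.3093 — 4 statements merged into one kernel-verified Lean document; each statement's English description precedes it below -/
import Mathlib

section
/- Let n ≥ 2 and D ≥ 1 be integers. There exists a code C ⊆ S_n with |C| ≤ ⌈n!·ln(n!)/B_C(D)⌉ such that every permutation π ∈ S_n satisfies d_C(π,C) ≤ D. -/
/-- Chebyshev distance between two permutations: the maximum of `|π i - σ i|`. -/
def chebDist {n : ℕ} (π σ : Equiv.Perm (Fin n)) : ℕ :=
  Finset.univ.sup fun i => Nat.dist (π i : ℕ) (σ i : ℕ)

/-- `chebBall n r` is the number of permutations in `S_n` at Chebyshev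
distance at most `r` from the identity. -/
def chebBall (n r : ℕ) : ℕ :=
  (Finset.univ.filter (fun σ : Equiv.Perm (Fin n) => chebDist σ 1 ≤ r)).card

/-- The minimal Chebyshev distance from `π` to a codeword of `C`. -/
noncomputable def chebDistToCode {n : ℕ} (π : Equiv.Perm (Fin n))
    (C : Finset (Equiv.Perm (Fin n))) : ℕ :=
  sInf (chebDist π '' ↑C)

/-- Greedy covering: if every point is related to exactly `B` points, then `k` points can be
chosen so that at most a fraction `(1 - B / |α|) ^ k` of the points is related to none of them. -/
theorem exists_finset_card_uncovered_le {α : Type*} [Fintype α] [DecidableEq α] [Nonempty α]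
    (R : α → α → Prop) [DecidableRel R] (B : ℕ)
    (hB : ∀ a, (Finset.univ.filter fun b => R a b).card = B) (k : ℕ) :
    ∃ C : Finset α, C.card ≤ k ∧
      ((Finset.univ.filter fun a => ∀ b ∈ C, ¬ R a b).card : ℝ) ≤
        Fintype.card α * (1 - B / Fintype.card α) ^ k := by
  have hN : (0 : ℝ) < Fintype.card α := by exact_mod_cast Fintype.card_pos
  have hBN : (B : ℝ) ≤ Fintype.card α := by
    obtain ⟨a⟩ := ‹Nonempty α›
    exact_mod_cast hB a ▸ Finset.card_le_univ _
  induction k with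
  | zero => exact ⟨∅, by simp⟩
  | succ k ih =>
    obtain ⟨C, hC, hU⟩ := ih
    set U := Finset.univ.filter fun a => ∀ b ∈ C, ¬ R a b with hUdef
    have hsum : ∑ b : α, (U.filter fun a => R a b).card = U.card * B := by
      have h := Finset.sum_card_bipartiteAbove_eq_sum_card_bipartiteBelow
        (s := U) (t := Finset.univ) R
      simp only [Finset.bipartiteAbove, Finset.bipartiteBelow, hB] at h
      simpa using h.symm
    obtain ⟨b, -, hb⟩ : ∃ b ∈ (Finset.univ : Finset α),
        (U.card * B / Fintype.card α : ℝ) ≤ (U.filter fun a => R a b).card := by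
      refine Finset.exists_le_of_sum_le Finset.univ_nonempty ?_
      rw [← Nat.cast_sum, hsum]
      simp only [Finset.sum_const, Finset.card_univ, nsmul_eq_mul]
      rw [mul_div_cancel₀ _ hN.ne']
      simp
    refine ⟨insert b C, (Finset.card_insert_le _ _).trans (by lia), ?_⟩
    have hEq : (Finset.univ.filter fun a => ∀ c ∈ insert b C, ¬ R a c) =
        U.filter fun a => ¬ R a b := by
      ext a
      simp [hUdef, and_comm]
    have hsplit : ((U.filter fun a => R a b).card : ℝ) + (U.filter fun a => ¬ R a b).card =
        U.card := by
      exact_mod_cast Finset.card_filter_add_card_filter_not (s := U) fun a => R a b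
    have hnonneg : (0 : ℝ) ≤ 1 - B / Fintype.card α := by
      rw [sub_nonneg, div_le_one hN]
      exact hBN
    rw [hEq]
    calc ((U.filter fun a => ¬ R a b).card : ℝ)
        ≤ U.card * (1 - B / Fintype.card α) := by
          rw [mul_sub, mul_one, ← mul_div_assoc]
          linarith
      _ ≤ Fintype.card α * (1 - B / Fintype.card α) ^ k * (1 - B / Fintype.card α) := by
          gcongr
      _ = _ := by ring

/-- If every point of a finite type with at least two elements is related to exactly `B > 0`
points, then `⌈|α| log |α| / B⌉` points suffice to cover the type. -/
theorem exists_covering_finset_card_le {α : Type*} [Fintype α] [DecidableEq α] [Nontrivial α]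
    (R : α → α → Prop) [DecidableRel R] (B : ℕ) (hB0 : 0 < B)
    (hB : ∀ a, (Finset.univ.filter fun b => R a b).card = B) :
    ∃ C : Finset α, C.card ≤ ⌈(Fintype.card α * Real.log (Fintype.card α)) / (B : ℝ)⌉₊ ∧
      ∀ a, ∃ b ∈ C, R a b := by
  have hN1 : (1 : ℝ) < Fintype.card α := by exact_mod_cast Fintype.one_lt_card
  have hN : (0 : ℝ) < Fintype.card α := one_pos.trans hN1
  have hBpos : (0 : ℝ) < B := by exact_mod_cast hB0
  set M := ⌈(Fintype.card α * Real.log (Fintype.card α)) / (B : ℝ)⌉₊ with hM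
  have hMle : (Fintype.card α * Real.log (Fintype.card α)) / (B : ℝ) ≤ M := Nat.le_ceil _
  have hM0 : M ≠ 0 := by
    have hlog := Real.log_pos hN1
    exact (Nat.ceil_pos.mpr (by positivity)).ne'
  obtain ⟨C, hC, hU⟩ := exists_finset_card_uncovered_le R B hB M
  refine ⟨C, hC, ?_⟩
  have hBN : (B : ℝ) ≤ Fintype.card α := by
    obtain ⟨a⟩ := (inferInstance : Nonempty α)
    exact_mod_cast hB a ▸ Finset.card_le_univ _
  have hx : (B / Fintype.card α : ℝ) ≠ 0 := by positivity
  have hlt : Fintype.card α * (1 - B / Fintype.card α : ℝ) ^ M < 1 := by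
    have hpow : (1 - B / Fintype.card α : ℝ) ^ M <
        Real.exp (-(B / Fintype.card α : ℝ)) ^ M := by
      refine pow_lt_pow_left₀ (Real.one_sub_lt_exp_neg hx) ?_ hM0
      rw [sub_nonneg, div_le_one hN]
      exact hBN
    have hexp : Real.exp (-(B / Fintype.card α : ℝ)) ^ M ≤ (Fintype.card α : ℝ)⁻¹ := by
      rw [← Real.exp_nat_mul, ← Real.exp_log (inv_pos.mpr hN), Real.log_inv]
      refine Real.exp_le_exp.mpr ?_
      rw [div_le_iff₀ hBpos] at hMle
      rw [mul_neg, neg_le_neg_iff, ← mul_div_assoc, le_div_iff₀ hN]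
      linarith
    calc Fintype.card α * (1 - B / Fintype.card α : ℝ) ^ M
        < Fintype.card α * (Fintype.card α : ℝ)⁻¹ := by
          gcongr
          exact hpow.trans_le hexp
      _ = 1 := mul_inv_cancel₀ hN.ne'
  have hcard : (Finset.univ.filter fun a => ∀ b ∈ C, ¬ R a b).card = 0 := by
    have h := hU.trans_lt hlt
    exact Nat.lt_one_iff.mp (by exact_mod_cast h)
  intro a
  by_contra! hcon
  have ha : a ∈ Finset.univ.filter fun a => ∀ b ∈ C, ¬ R a b := by simpa using hcon
  rw [Finset.card_eq_zero.mp hcard] at ha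
  simp at ha

theorem chebDist_comm {n : ℕ} (π σ : Equiv.Perm (Fin n)) : chebDist π σ = chebDist σ π := by
  simp only [chebDist, Nat.dist_comm]

/-- The Chebyshev distance is right-invariant. -/
theorem chebDist_mul_right {n : ℕ} (π σ τ : Equiv.Perm (Fin n)) :
    chebDist (π * τ) (σ * τ) = chebDist π σ := by
  have h := Finset.sup_map Finset.univ τ.toEmbedding
    fun i => Nat.dist (π i : ℕ) (σ i : ℕ)
  rw [Finset.map_univ_equiv] at h
  exact h.symm

/-- Every Chebyshev ball of radius `r` has `chebBall n r` elements. -/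
theorem card_filter_chebDist_le {n : ℕ} (r : ℕ) (π : Equiv.Perm (Fin n)) :
    (Finset.univ.filter fun σ => chebDist π σ ≤ r).card = chebBall n r := by
  refine Finset.card_equiv (Equiv.mulRight π⁻¹) fun σ => ?_
  have h := chebDist_mul_right σ π π⁻¹
  rw [mul_inv_cancel] at h
  simp [h, chebDist_comm π σ]

theorem chebBall_pos (n r : ℕ) : 0 < chebBall n r :=
  Finset.card_pos.mpr ⟨1, by simp [chebDist, Nat.dist_self]⟩

/-- There is a covering code for worst-case Chebyshev distortion `D` of size at most
`⌈n!·ln(n!)/B_C(D)⌉`. -/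
theorem stmt_3 (n D : ℕ) (hn : 2 ≤ n) (hD : 1 ≤ D) :
    ∃ C : Finset (Equiv.Perm (Fin n)),
      (C.card : ℤ) ≤ ⌈((n.factorial : ℝ) * Real.log (n.factorial : ℝ)) / (chebBall n D : ℝ)⌉ ∧
      ∀ π : Equiv.Perm (Fin n), ∃ σ ∈ C, chebDist π σ ≤ D := by
  have : Nontrivial (Fin n) := Fin.nontrivial_iff_two_le.mpr hn
  obtain ⟨C, hC, hcov⟩ := exists_covering_finset_card_le
    (fun π σ : Equiv.Perm (Fin n) => chebDist π σ ≤ D) (chebBall n D) (chebBall_pos n D)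
    (card_filter_chebDist_le D)
  rw [Fintype.card_perm, Fintype.card_fin] at hC
  refine ⟨C, ?_, hcov⟩
  rw [← Int.natCast_ceil_eq_ceil (by positivity)]
  exact_mod_cast hC
end

section
/- Let n and D be positive integers. There exists a code C ⊆ S_n with |C| ≤ (n!/B_K(D))·(1 + ln B_K(D)) such that every permutation π ∈ S_n satisfies d_K(π,C) ≤ D. -/
/-- The set of adjacent transpositions in `S_n`. -/
def adjacentTranspositions (n : ℕ) : Set (Equiv.Perm (Fin n)) :=
  {t | ∃ (i : ℕ) (h : i + 1 < n), t = Equiv.swap ⟨i, Nat.lt_of_succ_lt h⟩ ⟨i + 1, h⟩}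

/-- Kendall τ-distance: the minimum number of adjacent transpositions
needed to transform `π` into `σ`. -/
noncomputable def kendallDist {n : ℕ} (π σ : Equiv.Perm (Fin n)) : ℕ :=
  sInf {k | ∃ l : List (Equiv.Perm (Fin n)), l.length = k ∧
    (∀ t ∈ l, t ∈ adjacentTranspositions n) ∧ σ = π * l.prod}

/-- `kendallBall n r` is the number of permutations in `S_n` at Kendall
τ-distance at most `r` from the identity. -/
noncomputable def kendallBall (n r : ℕ) : ℕ :=
  (Finset.univ.filter (fun σ : Equiv.Perm (Fin n) => kendallDist σ 1 ≤ r)).card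

/-- The minimal Kendall τ-distance from `π` to a codeword of `C`. -/
noncomputable def kendallDistToCode {n : ℕ} (π : Equiv.Perm (Fin n))
    (C : Finset (Equiv.Perm (Fin n))) : ℕ :=
  sInf (kendallDist π '' ↑C)

/-- If `b ≤ a ≤ j`, each of the last `a - b` terms of the `a`-th harmonic number is at
least `1 / j`. -/
theorem sub_div_le_harmonic_sub {a b j : ℕ} (hba : b ≤ a) (haj : a ≤ j) :
    ((a : ℚ) - b) / j ≤ harmonic a - harmonic b := by
  induction a, hba using Nat.le_induction with
  | base => simp
  | succ a hba ih =>
    have hinv : (1 : ℚ) / j ≤ ((a + 1 : ℕ) : ℚ)⁻¹ := by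
      rw [one_div]
      exact inv_anti₀ (by positivity) (by exact_mod_cast haj)
    have hsplit : (((a + 1 : ℕ) : ℚ) - b) / j = ((a : ℚ) - b) / j + 1 / j := by
      push_cast
      ring
    rw [harmonic_succ, hsplit]
    linarith [ih (by omega)]

/-- Double counting: if every point lies in at least `d` members of the family `s`, the traces
of the family on `T` have total size at least `d * #T`. -/
theorem mul_card_le_sum_card_inter {ι α : Type*} [Fintype ι] [DecidableEq α]
    (s : ι → Finset α) (d : ℕ) (hd : ∀ a, d ≤ (Finset.univ.filter fun i => a ∈ s i).card)
    (T : Finset α) : d * T.card ≤ ∑ i, (s i ∩ T).card := by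
  calc d * T.card = ∑ _a ∈ T, d := by simp [mul_comm]
    _ ≤ ∑ a ∈ T, (Finset.univ.filter fun i => a ∈ s i).card :=
        Finset.sum_le_sum fun a _ => hd a
    _ = ∑ i, (s i ∩ T).card := by
        simp_rw [Finset.card_filter]
        rw [Finset.sum_comm]
        refine Finset.sum_congr rfl fun i _ => ?_
        rw [← Finset.card_filter, Finset.filter_mem_eq_inter, Finset.inter_comm]

/-- Greedy covering: if every point lies in at least `d` members of a finite family, any finite
set `U` has a subcover whose size is controlled by the harmonic numbers of the traces on `U`. -/
theorem exists_cover_mul_card_le_sum_harmonic {ι α : Type*} [Fintype ι] [DecidableEq ι]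
    [DecidableEq α] (s : ι → Finset α) (d : ℕ) (hpos : 0 < d)
    (hd : ∀ a, d ≤ (Finset.univ.filter fun i => a ∈ s i).card) (U : Finset α) :
    ∃ C : Finset ι, (∀ a ∈ U, ∃ i ∈ C, a ∈ s i) ∧
      (d : ℚ) * C.card ≤ ∑ i, harmonic (s i ∩ U).card := by
  induction U using Finset.strongInduction with
  | H U ih =>
    rcases U.eq_empty_or_nonempty with rfl | ⟨u, hu⟩
    · exact ⟨∅, by simp, by simp⟩
    obtain ⟨k, hk⟩ := Finset.card_pos.1 (hpos.trans_le (hd u))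
    have huk : u ∈ s k := by simpa using hk
    obtain ⟨m, -, hm⟩ := Finset.exists_max_image Finset.univ
      (fun i => (s i ∩ U).card) ⟨k, Finset.mem_univ k⟩
    have hj : 0 < (s m ∩ U).card :=
      (Finset.card_pos.2 ⟨u, Finset.mem_inter.2 ⟨huk, hu⟩⟩).trans_le (hm k (Finset.mem_univ k))
    have hssub : U \ s m ⊂ U := by
      obtain ⟨v, hv⟩ := Finset.card_pos.1 hj
      rw [Finset.mem_inter] at hv
      exact Finset.ssubset_iff_subset_ne.2 ⟨Finset.sdiff_subset, fun h =>
        (Finset.mem_sdiff.1 (h.symm ▸ hv.2 : v ∈ U \ s m)).2 hv.1⟩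
    obtain ⟨C, hcov, hcard⟩ := ih _ hssub
    refine ⟨insert m C, fun a ha => ?_, ?_⟩
    · by_cases ham : a ∈ s m
      · exact ⟨m, Finset.mem_insert_self m C, ham⟩
      · obtain ⟨i, hi, hai⟩ := hcov a (Finset.mem_sdiff.2 ⟨ha, ham⟩)
        exact ⟨i, Finset.mem_insert_of_mem hi, hai⟩
    have hdrop : ∀ i, ((s i ∩ (s m ∩ U)).card : ℚ) / (s m ∩ U).card ≤
        harmonic (s i ∩ U).card - harmonic (s i ∩ (U \ s m)).card := by
      intro i
      have hsum : (s i ∩ (s m ∩ U)).card + (s i ∩ (U \ s m)).card = (s i ∩ U).card := by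
        rw [← Finset.card_inter_add_card_sdiff (s i ∩ U) (s m)]
        congr 2 <;> (ext x; simp; tauto)
      have h := sub_div_le_harmonic_sub (b := (s i ∩ (U \ s m)).card) (by omega)
        (hm i (Finset.mem_univ i))
      rwa [← hsum, Nat.cast_add, add_sub_cancel_right, hsum] at h
    have htotal : (d : ℚ) ≤
        ∑ i, (harmonic (s i ∩ U).card - harmonic (s i ∩ (U \ s m)).card) := by
      refine le_trans ?_ (Finset.sum_le_sum fun i _ => hdrop i)
      rw [← Finset.sum_div, le_div_iff₀ (by exact_mod_cast hj)]
      exact_mod_cast mul_card_le_sum_card_inter s d hd (s m ∩ U)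
    rw [Finset.sum_sub_distrib] at htotal
    have hins : ((insert m C).card : ℚ) ≤ C.card + 1 := by
      exact_mod_cast Finset.card_insert_le m C
    calc (d : ℚ) * (insert m C).card ≤ d * (C.card + 1) := by gcongr
      _ ≤ _ := by linarith

/-- Left invariance of the Kendall τ-distance. -/
theorem kendallDist_eq_inv_mul_one {n : ℕ} (π σ : Equiv.Perm (Fin n)) :
    kendallDist π σ = kendallDist (σ⁻¹ * π) 1 := by
  unfold kendallDist
  congr 1
  ext k
  simp only [Set.mem_ofPred_eq, mul_assoc, eq_inv_mul_iff_mul_eq, mul_one]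

theorem kendallDist_self {n : ℕ} (π : Equiv.Perm (Fin n)) : kendallDist π π = 0 :=
  Nat.sInf_eq_zero.2 (Or.inl ⟨[], by simp⟩)

theorem kendallBall_pos (n r : ℕ) : 0 < kendallBall n r :=
  Finset.card_pos.2 ⟨1, by simp [kendallDist_self]⟩

/-- The set of centers within distance `r` of a point has the size of a ball. -/
theorem card_filter_kendallDist_le_right {n : ℕ} (r : ℕ) (π : Equiv.Perm (Fin n)) :
    (Finset.univ.filter fun σ => kendallDist π σ ≤ r).card = kendallBall n r := by
  refine Finset.card_equiv ((Equiv.inv _).trans (Equiv.mulRight π)) fun σ => ?_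
  simp [kendallDist_eq_inv_mul_one π σ]

/-- Balls of equal radius have equal size. -/
theorem card_filter_kendallDist_le_left {n : ℕ} (r : ℕ) (σ : Equiv.Perm (Fin n)) :
    (Finset.univ.filter fun π => kendallDist π σ ≤ r).card = kendallBall n r := by
  refine Finset.card_equiv (Equiv.mulLeft σ⁻¹) fun π => ?_
  simp [kendallDist_eq_inv_mul_one π σ]

/-- There is a covering code for worst-case Kendall τ-distortion `D` of size at most
`(n!/B_K(D))·(1 + ln B_K(D))`. -/
theorem stmt_4 (n D : ℕ) (hn : 0 < n) (hD : 0 < D) :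
    ∃ C : Finset (Equiv.Perm (Fin n)),
      (C.card : ℝ) ≤ ((n.factorial : ℝ) / (kendallBall n D : ℝ)) *
        (1 + Real.log (kendallBall n D : ℝ)) ∧
      ∀ π : Equiv.Perm (Fin n), ∃ σ ∈ C, kendallDist π σ ≤ D := by
  obtain ⟨C, hcov, hcard⟩ := exists_cover_mul_card_le_sum_harmonic
    (fun σ : Equiv.Perm (Fin n) => Finset.univ.filter fun π => kendallDist π σ ≤ D)
    (kendallBall n D) (kendallBall_pos n D)
    (fun π => by simp [card_filter_kendallDist_le_right]) Finset.univ
  refine ⟨C, ?_, fun π => by simpa using hcov π (Finset.mem_univ π)⟩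
  simp only [Finset.inter_univ, card_filter_kendallDist_le_left, Finset.sum_const,
    Finset.card_univ, Fintype.card_perm, Fintype.card_fin, nsmul_eq_mul] at hcard
  have hcard' : (kendallBall n D : ℝ) * C.card ≤ n.factorial * harmonic (kendallBall n D) := by
    exact_mod_cast hcard
  have hpos : (0 : ℝ) < kendallBall n D := by exact_mod_cast kendallBall_pos n D
  rw [div_mul_eq_mul_div, le_div_iff₀ hpos, mul_comm]
  refine hcard'.trans ?_
  gcongr
  exact harmonic_le_one_add_log _
end

section
/- Let n be a positive integer and let r be an integer with 1 ≤ r ≤ C(n,2). Then B_K(r) ≤ C(r+n−1, r), where C(·,·) denotes the binomial coefficient. -/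
open Finset

/-- The inversions of `σ`, as pairs of positions `(j, i)` with `j < i` and `σ i < σ j`. -/
def inversions {n : ℕ} (σ : Equiv.Perm (Fin n)) : Finset (Fin n × Fin n) :=
  univ.filter fun p => p.1 < p.2 ∧ σ p.2 < σ p.1

theorem mem_inversions {n : ℕ} {σ : Equiv.Perm (Fin n)} {j i : Fin n} :
    (j, i) ∈ inversions σ ↔ j < i ∧ σ i < σ j := by
  simp [inversions]

/-- The Lehmer code of `σ`: the entry at `i` counts the inversions with right position `i`. -/
def lehmerCode {n : ℕ} (σ : Equiv.Perm (Fin n)) (i : Fin n) : ℕ :=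
  (univ.filter fun j => j < i ∧ σ i < σ j).card

theorem sum_lehmerCode {n : ℕ} (σ : Equiv.Perm (Fin n)) :
    ∑ i, lehmerCode σ i = (inversions σ).card := by
  simp only [lehmerCode, inversions, card_filter, Fintype.sum_prod_type]
  exact sum_comm

theorem lehmerCode_zero {n : ℕ} (σ : Equiv.Perm (Fin (n + 1))) : lehmerCode σ 0 = 0 := by
  simp [lehmerCode]

theorem card_inversions_mul_le {n : ℕ} {t : Equiv.Perm (Fin n)}
    (ht : t ∈ adjacentTranspositions n) (σ : Equiv.Perm (Fin n)) :
    (inversions (t * σ)).card ≤ (inversions σ).card + 1 := by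
  obtain ⟨k, hk, rfl⟩ := ht
  have key : ∀ a b : Fin n, a < b →
      Equiv.swap (⟨k, Nat.lt_of_succ_lt hk⟩ : Fin n) ⟨k + 1, hk⟩ b <
        Equiv.swap (⟨k, Nat.lt_of_succ_lt hk⟩ : Fin n) ⟨k + 1, hk⟩ a →
      a = ⟨k, Nat.lt_of_succ_lt hk⟩ ∧ b = ⟨k + 1, hk⟩ := by
    intro a b hab h
    simp only [Equiv.swap_apply_def] at h
    split_ifs at h <;> simp only [Fin.ext_iff, Fin.lt_def] at * <;> omega
  refine (card_le_card (t := insert (σ⁻¹ ⟨k, Nat.lt_of_succ_lt hk⟩, σ⁻¹ ⟨k + 1, hk⟩)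
    (inversions σ)) ?_).trans (card_insert_le _ _)
  rintro ⟨j, i⟩ h
  rw [mem_inversions] at h
  rw [mem_insert, mem_inversions, Prod.mk.injEq]
  by_cases hlt : σ i < σ j
  · exact Or.inr ⟨h.1, hlt⟩
  · have hne : σ j ≠ σ i := fun e => h.1.ne (σ.injective e)
    obtain ⟨h₁, h₂⟩ := key _ _ (lt_of_le_of_ne (not_lt.1 hlt) hne) h.2
    left
    simp [← h₁, ← h₂]

theorem card_inversions_prod_le_length {n : ℕ} (l : List (Equiv.Perm (Fin n)))
    (hl : ∀ t ∈ l, t ∈ adjacentTranspositions n) : (inversions l.prod).card ≤ l.length := by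
  induction l with
  | nil =>
    rw [List.prod_nil, List.length_nil, Nat.le_zero, card_eq_zero, eq_empty_iff_forall_notMem]
    rintro ⟨j, i⟩ h
    exact (mem_inversions.1 h).1.asymm (mem_inversions.1 h).2
  | cons t l ih =>
    rw [List.prod_cons, List.length_cons]
    have h₁ := card_inversions_mul_le (hl t (by simp)) l.prod
    have h₂ := ih fun s hs => hl s (by simp [hs])
    omega

theorem exists_list_adjacentTranspositions_prod_eq {n : ℕ} (σ : Equiv.Perm (Fin n)) :
    ∃ l : List (Equiv.Perm (Fin n)), (∀ t ∈ l, t ∈ adjacentTranspositions n) ∧ l.prod = σ := by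
  cases n with
  | zero => exact ⟨[], by simp, Subsingleton.elim _ _⟩
  | succ m =>
    have hσ : σ ∈ Submonoid.closure
        (Set.range fun i : Fin m => Equiv.swap i.castSucc i.succ) := by
      rw [Equiv.Perm.mclosure_swap_castSucc_succ]
      trivial
    obtain ⟨l, hl, hprod⟩ := Submonoid.exists_list_of_mem_closure hσ
    refine ⟨l, fun t ht => ?_, hprod⟩
    obtain ⟨i, rfl⟩ := hl t ht
    exact ⟨i, by omega, rfl⟩

theorem card_inversions_inv_le_kendallDist {n : ℕ} (σ : Equiv.Perm (Fin n)) :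
    (inversions σ⁻¹).card ≤ kendallDist σ 1 := by
  obtain ⟨l₀, hl₀, hprod₀⟩ := exists_list_adjacentTranspositions_prod_eq σ⁻¹
  have hne : {k | ∃ l : List (Equiv.Perm (Fin n)), l.length = k ∧
      (∀ t ∈ l, t ∈ adjacentTranspositions n) ∧ 1 = σ * l.prod}.Nonempty :=
    ⟨_, l₀, rfl, hl₀, by simp [hprod₀]⟩
  obtain ⟨l, hlen, hl, hprod⟩ := Nat.sInf_mem hne
  rw [inv_eq_of_mul_eq_one_right hprod.symm, kendallDist, ← hlen]
  exact card_inversions_prod_le_length l hl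

theorem lehmerCode_eq_card_values {n : ℕ} (σ : Equiv.Perm (Fin n)) (i : Fin n) :
    lehmerCode σ i = (univ.filter fun a => ¬ i < σ⁻¹ a ∧ σ i < a).card := by
  rw [lehmerCode, ← card_map σ.toEmbedding]
  congr 1
  ext a
  simp only [mem_map, mem_filter, mem_univ, true_and, Equiv.coe_toEmbedding, not_lt]
  constructor
  · rintro ⟨j, ⟨hj, hlt⟩, rfl⟩
    simpa using ⟨hj.le, hlt⟩
  · rintro ⟨hle, hlt⟩
    refine ⟨σ⁻¹ a, ⟨lt_of_le_of_ne hle ?_, by simpa using hlt⟩, by simp⟩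
    rintro rfl
    simp at hlt

theorem lehmerCode_lt_of_apply_lt {n : ℕ} {σ τ : Equiv.Perm (Fin n)} {i : Fin n}
    (h : ∀ j, i < j → σ j = τ j) (hlt : σ i < τ i) : lehmerCode τ i < lehmerCode σ i := by
  rw [lehmerCode_eq_card_values, lehmerCode_eq_card_values]
  have hmem : ∀ a, i < σ⁻¹ a → i < τ⁻¹ a := by
    intro a ha
    have := h _ ha
    rw [← Equiv.Perm.mul_apply, mul_inv_cancel, Equiv.Perm.one_apply] at this
    rwa [Equiv.Perm.inv_eq_iff_eq.2 this]
  refine card_lt_card ((ssubset_iff_of_subset ?_).2 ⟨τ i, ?_, by simp⟩)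
  · intro a
    simp only [mem_filter, mem_univ, true_and]
    exact fun ⟨h₁, h₂⟩ => ⟨fun h' => h₁ (hmem a h'), hlt.trans h₂⟩
  · simp only [mem_filter, mem_univ, true_and]
    exact ⟨fun h' => by simpa using hmem _ h', hlt⟩

theorem lehmerCode_injective (n : ℕ) :
    Function.Injective (lehmerCode : Equiv.Perm (Fin n) → Fin n → ℕ) := by
  intro σ τ h
  ext1 i
  induction i using WellFoundedGT.induction with
  | ind i ih =>
    rcases lt_trichotomy (σ i) (τ i) with hlt | heq | hlt
    · exact absurd (congrFun h i) (lehmerCode_lt_of_apply_lt ih hlt).ne'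
    · exact heq
    · exact absurd (congrFun h i) (lehmerCode_lt_of_apply_lt (fun j hj => (ih j hj).symm) hlt).ne

/-- For `1 ≤ r ≤ C(n,2)`, the Kendall τ-ball satisfies `B_K(r) ≤ C(r+n-1, r)`. -/
theorem stmt_6 (n r : ℕ) (hn : 0 < n) (hr1 : 1 ≤ r) (hr2 : r ≤ n.choose 2) :
    kendallBall n r ≤ (r + n - 1).choose r := by
  obtain ⟨m, rfl⟩ := Nat.exists_eq_add_one.2 hn
  -- Complete the Lehmer code of `σ⁻¹`, whose entry at `0` vanishes, to a sequence with sum `r`.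
  let f (σ : Equiv.Perm (Fin (m + 1))) : Fin (m + 1) → ℕ :=
    lehmerCode σ⁻¹ + Pi.single 0 (r - ∑ i, lehmerCode σ⁻¹ i)
  have hcard := card_finsuppAntidiag_nat_eq_choose (s := (univ : Finset (Fin (m + 1)))) r
  rw [card_univ, Fintype.card_fin, add_comm (m + 1) r] at hcard
  rw [kendallBall, ← hcard]
  refine card_le_card_of_injOn (fun σ => Finsupp.equivFunOnFinite.symm (f σ)) ?_ ?_
  · intro σ hσ
    have hle : ∑ i, lehmerCode σ⁻¹ i ≤ r := by
      rw [sum_lehmerCode]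
      exact (card_inversions_inv_le_kendallDist σ).trans (by simpa using hσ)
    simp [f, sum_add_distrib, hle]
  · intro σ _ τ _ h
    have hf : f σ = f τ := Finsupp.equivFunOnFinite.symm.injective h
    refine inv_injective (lehmerCode_injective _ (funext fun i => ?_))
    rcases eq_or_ne i 0 with rfl | hi
    · rw [lehmerCode_zero, lehmerCode_zero]
    · simpa [f, hi] using congrFun hf i
end

section
/- Let n and D be positive integers with 1 ≤ D < n. There exists a code C ⊆ S_n with |C| ≤ 64 · n^{3/2} · n! · D^D · n^n / (n+D)^{n+D} such that every permutation π ∈ S_n satisfies d_K(π,C) ≤ D. (Equivalently, with δ = D/n, the minimum worst-case covering code size M̂_K(D) satisfies (1/n)·lg(M̂_K(D)/n!) ≤ −lg((1+δ)^{1+δ}/δ^δ) + (3·lg n + 12)/(2n).) -/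
open Finset

/-! ### Greedy covering of finite groups -/

section Covering

variable {G : Type*} [Group G] [Fintype G] [DecidableEq G]

/-- By averaging, some `g` satisfies `π⁻¹ * g ∈ S` for at least a fraction `S.card / |G|` of
the elements `π` of `U`. -/
theorem exists_card_mul_card_le (U S : Finset G) :
    ∃ g : G, U.card * S.card ≤ Fintype.card G * {π ∈ U | π⁻¹ * g ∈ S}.card := by
  have hfiber : ∀ π ∈ U, {g : G | π⁻¹ * g ∈ S}.toFinset.card = S.card := by
    intro π _
    have : {g : G | π⁻¹ * g ∈ S}.toFinset = S.map (Equiv.mulLeft π).toEmbedding := by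
      ext g
      simp [Finset.mem_map_equiv]
    rw [this, card_map]
  have hdouble : ∑ g : G, {π ∈ U | π⁻¹ * g ∈ S}.card = U.card * S.card := by
    have := sum_card_bipartiteAbove_eq_sum_card_bipartiteBelow (s := U) (t := univ)
      (fun π g : G => π⁻¹ * g ∈ S)
    simp only [bipartiteAbove, bipartiteBelow] at this
    rw [← this, sum_congr rfl, sum_const, smul_eq_mul]
    intro π hπ
    rw [← hfiber π hπ]
    congr 1
    ext g
    simp
  by_contra! h
  have hlt := sum_lt_sum_of_nonempty (s := (univ : Finset G)) ⟨1, mem_univ _⟩ fun g _ => h g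
  rw [← mul_sum, hdouble, sum_const, smul_eq_mul, card_univ] at hlt
  exact lt_irrefl _ hlt

theorem exists_partial_cover (S : Finset G) (k : ℕ) :
    ∃ C : Finset G, C.card ≤ k ∧
      (({π : G | ∀ σ ∈ C, π⁻¹ * σ ∉ S} : Finset G).card : ℝ) ≤
        Fintype.card G * (1 - S.card / Fintype.card G : ℝ) ^ k := by
  induction k with
  | zero => exact ⟨∅, by simp, by simp⟩
  | succ k ih =>
    obtain ⟨C, hC, hU⟩ := ih
    set U : Finset G := {π : G | ∀ σ ∈ C, π⁻¹ * σ ∉ S} with hUdef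
    obtain ⟨g, hg⟩ := exists_card_mul_card_le U S
    have hpos : (0 : ℝ) < Fintype.card G := by exact_mod_cast Fintype.card_pos
    have hSle : (S.card : ℝ) / Fintype.card G ≤ 1 := by
      rw [div_le_one hpos]
      exact_mod_cast card_le_univ S
    refine ⟨insert g C, (card_insert_le _ _).trans (by omega), ?_⟩
    have hsplit := card_filter_add_card_filter_not (s := U) (fun π => π⁻¹ * g ∈ S)
    have heq : ({π : G | ∀ σ ∈ insert g C, π⁻¹ * σ ∉ S} : Finset G) =
        {π ∈ U | ¬ π⁻¹ * g ∈ S} := by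
      ext π
      simp [hUdef, and_comm]
    rw [heq]
    have hsplit' : (({π ∈ U | π⁻¹ * g ∈ S}.card : ℕ) : ℝ) +
        (({π ∈ U | ¬ π⁻¹ * g ∈ S}.card : ℕ) : ℝ) = U.card := by exact_mod_cast hsplit
    have hg' : (U.card : ℝ) * S.card ≤ Fintype.card G * ({π ∈ U | π⁻¹ * g ∈ S}.card : ℕ) := by
      exact_mod_cast hg
    have hfrac : (U.card : ℝ) * (S.card / Fintype.card G) ≤
        ({π ∈ U | π⁻¹ * g ∈ S}.card : ℕ) := by
      rw [← mul_div_assoc, div_le_iff₀ hpos]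
      linarith
    calc (({π ∈ U | ¬ π⁻¹ * g ∈ S}.card : ℕ) : ℝ)
        ≤ U.card * (1 - S.card / Fintype.card G) := by linarith
      _ ≤ Fintype.card G * (1 - S.card / Fintype.card G : ℝ) ^ k *
          (1 - S.card / Fintype.card G) := by
        gcongr
      _ = _ := by ring

/-- Greedy covering: few points `σ` suffice for every `π` to have some `π⁻¹ * σ` in `S`. -/
theorem exists_cover (S : Finset G) (hS : S.Nonempty) (L : ℝ) (hL : 0 ≤ L) :
    ∃ C : Finset G, (C.card : ℝ) ≤
        (L + 1) * (Fintype.card G / S.card) + Fintype.card G * Real.exp (-L) ∧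
      ∀ π : G, ∃ σ ∈ C, π⁻¹ * σ ∈ S := by
  have hpos : (0 : ℝ) < Fintype.card G := by exact_mod_cast Fintype.card_pos
  have hSpos : (0 : ℝ) < S.card := by exact_mod_cast hS.card_pos
  have hSle : (S.card : ℝ) ≤ Fintype.card G := by exact_mod_cast card_le_univ S
  set k := ⌈L * (Fintype.card G / S.card : ℝ)⌉₊ with hk
  obtain ⟨C, hC, hU⟩ := exists_partial_cover S k
  set U : Finset G := {π : G | ∀ σ ∈ C, π⁻¹ * σ ∉ S} with hUdef
  obtain ⟨s, hs⟩ := hS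
  refine ⟨C ∪ U.image (· * s), ?_, ?_⟩
  · have hcard : ((C ∪ U.image (· * s)).card : ℝ) ≤ k + U.card := by
      exact_mod_cast (card_union_le _ _).trans (add_le_add hC card_image_le)
    have hceil : (k : ℝ) < L * (Fintype.card G / S.card) + 1 := Nat.ceil_lt_add_one (by positivity)
    have hone : (1 : ℝ) ≤ Fintype.card G / S.card := (one_le_div hSpos).2 hSle
    have hexp : (1 - S.card / Fintype.card G : ℝ) ^ k ≤ Real.exp (-L) := by
      calc (1 - S.card / Fintype.card G : ℝ) ^ k
          ≤ Real.exp (-(S.card / Fintype.card G)) ^ k := by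
            gcongr
            · rw [sub_nonneg]
              exact (div_le_one hpos).2 hSle
            · exact Real.one_sub_le_exp_neg _
        _ = Real.exp (-(k * (S.card / Fintype.card G))) := by
            rw [← Real.exp_nat_mul]
            ring_nf
        _ ≤ Real.exp (-L) := by
            have hge : L * (Fintype.card G / S.card : ℝ) ≤ k := Nat.le_ceil _
            have := mul_le_mul_of_nonneg_right hge
              (by positivity : (0 : ℝ) ≤ S.card / Fintype.card G)
            have hcancel : L * (Fintype.card G / S.card : ℝ) * (S.card / Fintype.card G) = L := by
              field_simp
            gcongr
            linarith
    have := mul_le_mul_of_nonneg_left hexp hpos.le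
    linarith
  · intro π
    by_cases h : ∃ σ ∈ C, π⁻¹ * σ ∈ S
    · obtain ⟨σ, hσ, hm⟩ := h
      exact ⟨σ, mem_union_left _ hσ, hm⟩
    · push Not at h
      exact ⟨π * s, mem_union_right _ (mem_image_of_mem _ (by simpa [hUdef] using h)), by simpa⟩

end Covering

/-! ### Counting short products of adjacent transpositions -/

section Counting

/-- The permutations that are products of at most `r` adjacent transpositions. -/
noncomputable def adjacentBall (n r : ℕ) : Finset (Equiv.Perm (Fin n)) := by
  classical exact {τ | ∃ l : List (Equiv.Perm (Fin n)), l.length ≤ r ∧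
    (∀ t ∈ l, t ∈ adjacentTranspositions n) ∧ τ = l.prod}

theorem mem_adjacentBall {n r : ℕ} {τ : Equiv.Perm (Fin n)} :
    τ ∈ adjacentBall n r ↔ ∃ l : List (Equiv.Perm (Fin n)), l.length ≤ r ∧
      (∀ t ∈ l, t ∈ adjacentTranspositions n) ∧ τ = l.prod := by
  simp [adjacentBall]

theorem one_mem_adjacentBall (n r : ℕ) : 1 ∈ adjacentBall n r :=
  mem_adjacentBall.2 ⟨[], by simp⟩

theorem kendallDist_le_of_mem_adjacentBall {n r : ℕ} {π σ : Equiv.Perm (Fin n)}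
    (h : π⁻¹ * σ ∈ adjacentBall n r) : kendallDist π σ ≤ r := by
  obtain ⟨l, hl, hadj, hprod⟩ := mem_adjacentBall.1 h
  refine le_trans (Nat.sInf_le ?_) hl
  exact ⟨l, rfl, hadj, by rw [← hprod, mul_inv_cancel_left]⟩

/-- The extension of a permutation of `Fin n` to `Fin (n + 1)` fixing `0` and shifting the rest. -/
def permSucc (n : ℕ) : Equiv.Perm (Fin n) →* Equiv.Perm (Fin (n + 1)) where
  toFun e := Equiv.Perm.decomposeFin.symm (0, e)
  map_one' := Equiv.Perm.decomposeFin_symm_of_one 0 |>.trans (Equiv.swap_self 0)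
  map_mul' e f := by
    ext x
    refine Fin.cases ?_ (fun x => ?_) x <;> simp

theorem permSucc_apply_zero {n : ℕ} (e : Equiv.Perm (Fin n)) : permSucc n e 0 = 0 := by
  simp [permSucc]

theorem permSucc_injective (n : ℕ) : Function.Injective (permSucc n) := by
  intro e f h
  simpa [permSucc] using h

theorem permSucc_mem_adjacentTranspositions {n : ℕ} {t : Equiv.Perm (Fin n)}
    (ht : t ∈ adjacentTranspositions n) : permSucc n t ∈ adjacentTranspositions (n + 1) := by
  obtain ⟨i, hi, rfl⟩ := ht
  refine ⟨i + 1, by omega, ?_⟩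
  ext x
  refine Fin.cases ?_ (fun x => ?_) x
  · rw [permSucc_apply_zero, Equiv.swap_apply_of_ne_of_ne] <;> simp [Fin.ext_iff]
  · have hswap := (Fin.succ_injective n).map_swap ⟨i, Nat.lt_of_succ_lt hi⟩ ⟨i + 1, hi⟩ x
    simp only [permSucc, MonoidHom.coe_mk, OneHom.coe_mk,
      Equiv.Perm.decomposeFin_symm_apply_succ, Equiv.swap_self, Equiv.refl_apply]
    rw [hswap]
    rfl

theorem permSucc_mem_adjacentBall {n r : ℕ} {τ : Equiv.Perm (Fin n)}
    (h : τ ∈ adjacentBall n r) : permSucc n τ ∈ adjacentBall (n + 1) r := by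
  obtain ⟨l, hl, hadj, rfl⟩ := mem_adjacentBall.1 h
  refine mem_adjacentBall.2 ⟨l.map (permSucc n), by simpa, ?_, by rw [map_list_prod]⟩
  simp only [List.mem_map, forall_exists_index, and_imp, forall_apply_eq_imp_iff₂]
  exact fun t ht => permSucc_mem_adjacentTranspositions (hadj t ht)

theorem mul_mem_adjacentBall {n r s : ℕ} {τ υ : Equiv.Perm (Fin n)}
    (hτ : τ ∈ adjacentBall n r) (hυ : υ ∈ adjacentBall n s) : τ * υ ∈ adjacentBall n (r + s) := by
  obtain ⟨l, hl, hadj, rfl⟩ := mem_adjacentBall.1 hτ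
  obtain ⟨l', hl', hadj', rfl⟩ := mem_adjacentBall.1 hυ
  refine mem_adjacentBall.2 ⟨l ++ l', by simp; omega, ?_, by simp⟩
  intro t ht
  rcases List.mem_append.1 ht with h | h
  exacts [hadj t h, hadj' t h]

theorem exists_mem_adjacentBall_apply_zero (n j : ℕ) (hj : j < n + 1) :
    ∃ τ ∈ adjacentBall (n + 1) j, (τ 0 : ℕ) = j := by
  induction j with
  | zero => exact ⟨1, one_mem_adjacentBall _ _, by simp⟩
  | succ j ih =>
    obtain ⟨τ, hτ, h0⟩ := ih (by omega)
    refine ⟨Equiv.swap ⟨j, by omega⟩ ⟨j + 1, hj⟩ * τ, ?_, ?_⟩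
    · suffices h : Equiv.swap ⟨j, by omega⟩ ⟨j + 1, hj⟩ * τ ∈ adjacentBall (n + 1) (1 + j) by
        rwa [Nat.add_comm 1 j] at h
      refine mul_mem_adjacentBall (mem_adjacentBall.2 ⟨[Equiv.swap ⟨j, by omega⟩ ⟨j + 1, hj⟩],
        by simp, ?_, by simp⟩) hτ
      intro t ht
      rw [List.mem_singleton] at ht
      exact ⟨j, hj, ht⟩
    · have : τ 0 = ⟨j, by omega⟩ := Fin.ext h0
      rw [Equiv.Perm.mul_apply, this, Equiv.swap_apply_left]

theorem sum_card_adjacentBall_le (n r : ℕ) :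
    ∑ j ∈ range (r + 1) with j < n + 1, (adjacentBall n (r - j)).card ≤
      (adjacentBall (n + 1) r).card := by
  classical
  choose c hc hc0 using exists_mem_adjacentBall_apply_zero n
  rw [← card_sigma]
  refine card_le_card_of_injOn
    (fun p => if h : p.1 < n + 1 then c p.1 h * permSucc n p.2 else 1) ?_ ?_
  · rintro ⟨j, τ⟩ hp
    simp only [coe_sigma, Set.mem_sigma_iff, mem_coe, mem_filter, mem_range] at hp
    obtain ⟨⟨hjr, hjn⟩, hτ⟩ := hp
    simp only [hjn, dif_pos]
    have := mul_mem_adjacentBall (hc j hjn) (permSucc_mem_adjacentBall hτ)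
    rwa [show j + (r - j) = r by omega] at this
  · rintro ⟨j, τ⟩ hp ⟨j', τ'⟩ hp' heq
    simp only [coe_sigma, Set.mem_sigma_iff, mem_coe, mem_filter, mem_range] at hp hp'
    simp only [hp.1.2, hp'.1.2, dif_pos] at heq
    have hjj : j = j' := by
      rw [← hc0 j hp.1.2, ← hc0 j' hp'.1.2]
      have := congrArg (fun e : Equiv.Perm (Fin (n + 1)) => (e 0 : ℕ)) heq
      simpa [permSucc_apply_zero] using this
    subst hjj
    rw [permSucc_injective n (mul_left_cancel heq)]

/-- The number `C(m + (r - i), m)` of ordered `m`-tuples of naturals with sum at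
most `r - i`, read as `0` when `r < i`. -/
def shiftedChoose (m r i : ℕ) : ℕ := if i ≤ r then (m + (r - i)).choose m else 0

theorem sum_shiftedChoose (m r i : ℕ) :
    ∑ j ∈ range (r + 1), shiftedChoose m (r - j) i = shiftedChoose (m + 1) r i := by
  rw [← sum_range_reflect]
  have hsum : ∀ r, ∑ k ∈ range (r + 1), shiftedChoose m k i = shiftedChoose (m + 1) r i := by
    intro r
    induction r with
    | zero => by_cases h : i = 0 <;> simp [shiftedChoose, h]
    | succ r ih =>
      rw [sum_range_succ, ih]
      unfold shiftedChoose
      rcases lt_trichotomy i (r + 1) with h | h | h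
      · rw [if_pos (by omega), if_pos (by omega), if_pos (by omega),
          show m + 1 + (r + 1 - i) = (m + (r + 1 - i)) + 1 by omega, Nat.choose_succ_succ,
          show m + 1 + (r - i) = m + (r + 1 - i) by omega, add_comm]
      · subst h
        simp
      · rw [if_neg (by omega), if_neg (by omega), if_neg (by omega)]
  rw [← hsum r]
  refine sum_congr rfl fun j hj => ?_
  rw [mem_range] at hj
  congr 1
  omega

theorem shiftedChoose_zero_right (m r : ℕ) : shiftedChoose m r 0 = (m + r).choose m := by
  simp [shiftedChoose]

/-- Union bound for the inversion tables with an entry exceeding its range. -/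
theorem choose_le_card_adjacentBall_add (m r : ℕ) :
    (m + r).choose m ≤
      (adjacentBall (m + 1) r).card + ∑ i ∈ range m, shiftedChoose m r (i + 2) := by
  induction m generalizing r with
  | zero => simpa using card_pos.2 ⟨1, one_mem_adjacentBall 1 r⟩
  | succ m ih =>
    have htail : ∑ j ∈ range (r + 1) with ¬ j < m + 1 + 1, (m + (r - j)).choose m ≤
        shiftedChoose (m + 1) r (m + 2) := by
      rw [← sum_shiftedChoose]
      by_cases hmr : m + 2 ≤ r
      · refine (sum_le_sum_of_subset_of_nonneg (t := (range (r - (m + 2) + 1)).map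
            (addRightEmbedding (m + 2))) ?_ (fun _ _ _ => Nat.zero_le _)).trans ?_
        · intro j hj
          simp only [mem_filter, mem_range] at hj
          simp only [mem_map, mem_range, addRightEmbedding_apply]
          exact ⟨j - (m + 2), by omega, by omega⟩
        · rw [sum_map]
          refine (sum_le_sum fun j hj => ?_).trans
            (sum_le_sum_of_subset (range_subset_range.2 (by omega : r - (m + 2) + 1 ≤ r + 1)))
          rw [mem_range] at hj
          simp only [addRightEmbedding_apply, shiftedChoose]
          rw [if_pos (by omega), show r - (j + (m + 2)) = r - j - (m + 2) by omega]
      · rw [sum_eq_zero]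
        · exact Nat.zero_le _
        · intro j hj
          simp only [mem_filter, mem_range] at hj
          omega
    have hhead : ∑ j ∈ range (r + 1) with j < m + 1 + 1, (m + (r - j)).choose m ≤
        (adjacentBall (m + 1 + 1) r).card + ∑ i ∈ range m, shiftedChoose (m + 1) r (i + 2) := by
      calc ∑ j ∈ range (r + 1) with j < m + 1 + 1, (m + (r - j)).choose m
          ≤ ∑ j ∈ range (r + 1) with j < m + 1 + 1, ((adjacentBall (m + 1) (r - j)).card +
              ∑ i ∈ range m, shiftedChoose m (r - j) (i + 2)) := sum_le_sum fun j _ => ih (r - j)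
        _ ≤ (adjacentBall (m + 1 + 1) r).card +
            ∑ j ∈ range (r + 1), ∑ i ∈ range m, shiftedChoose m (r - j) (i + 2) := by
          rw [sum_add_distrib]
          exact add_le_add (sum_card_adjacentBall_le (m + 1) r)
            (sum_le_sum_of_subset (filter_subset _ _))
        _ = _ := by
          rw [sum_comm]
          simp only [sum_shiftedChoose]
    have htotal : (m + 1 + r).choose (m + 1) = ∑ j ∈ range (r + 1), (m + (r - j)).choose m := by
      simpa only [shiftedChoose_zero_right] using (sum_shiftedChoose m r 0).symm
    rw [htotal, ← sum_filter_add_sum_filter_not _ (fun j => j < m + 1 + 1), sum_range_succ]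
    omega

theorem two_mul_shiftedChoose_succ_le {m r : ℕ} (h : r ≤ m) (i : ℕ) :
    2 * shiftedChoose m r (i + 1) ≤ shiftedChoose m r i := by
  unfold shiftedChoose
  split_ifs with h1 h2
  · obtain ⟨k, hk⟩ : ∃ k, r - i = k + 1 := ⟨r - i - 1, by omega⟩
    rw [show r - (i + 1) = k by omega, hk]
    have hmul := Nat.add_one_mul_choose_eq (m + k) k
    have hsymm : (m + k).choose k = (m + k).choose m := Nat.choose_symm_add.symm
    have hsymm' : (m + k + 1).choose (k + 1) = (m + (k + 1)).choose m := by
      rw [add_assoc]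
      exact Nat.choose_symm_add.symm
    rw [hsymm, hsymm'] at hmul
    have hle : 2 * (k + 1) ≤ m + k + 1 := by omega
    refine Nat.le_of_mul_le_mul_right (c := k + 1) ?_ (Nat.succ_pos k)
    calc 2 * (m + k).choose m * (k + 1) = 2 * (k + 1) * (m + k).choose m := by ring
      _ ≤ (m + k + 1) * (m + k).choose m := Nat.mul_le_mul_right _ hle
      _ = _ := hmul
  · omega
  · simp
  · simp

theorem choose_le_two_mul_card_adjacentBall {m r : ℕ} (h : r ≤ m) :
    (m + r).choose m ≤ 2 * (adjacentBall (m + 1) r).card := by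
  have hgeom : ∀ k, ∑ i ∈ range k, shiftedChoose m r (i + 2) + shiftedChoose m r (k + 1) ≤
      shiftedChoose m r 1 := by
    intro k
    induction k with
    | zero => simp
    | succ k ih =>
      rw [sum_range_succ]
      have : 2 * shiftedChoose m r (k + 2) ≤ shiftedChoose m r (k + 1) :=
        two_mul_shiftedChoose_succ_le h (k + 1)
      rw [show k + 1 + 1 = k + 2 from rfl]
      omega
  have h1 := hgeom m
  have h2 := two_mul_shiftedChoose_succ_le h 0
  have h3 := choose_le_card_adjacentBall_add m r
  rw [shiftedChoose_zero_right, zero_add] at h2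
  omega

theorem choose_le_four_mul_card_adjacentBall {n r : ℕ} (h : r < n) :
    (n + r).choose n ≤ 4 * (adjacentBall n r).card := by
  obtain ⟨m, rfl⟩ : ∃ m, n = m + 1 := ⟨n - 1, by omega⟩
  have h1 := choose_le_two_mul_card_adjacentBall (show r ≤ m by omega)
  have hmul := Nat.add_one_mul_choose_eq (m + r) m
  have h2 : (m + 1 + r).choose (m + 1) ≤ 2 * (m + r).choose m := by
    refine Nat.le_of_mul_le_mul_right (c := m + 1) ?_ (Nat.succ_pos m)
    rw [show m + 1 + r = m + r + 1 by omega, ← hmul]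
    calc (m + r + 1) * (m + r).choose m ≤ (2 * (m + 1)) * (m + r).choose m :=
          Nat.mul_le_mul_right _ (by omega)
      _ = _ := by ring
  omega

end Counting

/-! ### Entropy estimates -/

section Estimates

open Real

theorem factorial_le_exp_one_mul_sqrt {n : ℕ} (hn : n ≠ 0) :
    (n.factorial : ℝ) ≤ exp 1 * √n * (n / exp 1) ^ n := by
  obtain ⟨m, rfl⟩ := Nat.exists_eq_succ_of_ne_zero hn
  have h := Stirling.stirlingSeq'_antitone (Nat.zero_le m)
  simp only [Function.comp_apply, Nat.succ_eq_add_one, zero_add, Stirling.stirlingSeq_one] at h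
  rw [Stirling.stirlingSeq, div_le_iff₀ (by positivity)] at h
  refine h.trans (le_of_eq ?_)
  rw [Real.sqrt_mul (by norm_num)]
  have : √(2 : ℝ) ≠ 0 := by positivity
  field_simp

theorem pow_div_le_choose {n D : ℕ} (hn : n ≠ 0) (hD : D ≠ 0) :
    ((n : ℝ) + D) ^ (n + D) / (D ^ D * n ^ n) ≤ 5 * √n * (n + D).choose n := by
  have hlow := Stirling.le_factorial_stirling (n + D)
  have hnf := factorial_le_exp_one_mul_sqrt hn
  have hDf := factorial_le_exp_one_mul_sqrt hD
  have hchoose : ((n + D).choose n : ℝ) * (n.factorial * D.factorial) = (n + D).factorial := by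
    have := Nat.add_choose_mul_factorial_mul_factorial n D
    rw [← this, Nat.choose_symm_add]
    push_cast
    ring
  have hn0 : (0 : ℝ) < n := by positivity
  have hD0 : (0 : ℝ) < D := by positivity
  have hsqrt : exp 1 * exp 1 * √D ≤ 5 * √(2 * π * (n + D : ℕ)) := by
    have he := exp_one_lt_d9
    have he0 := exp_pos 1
    have h1 : exp 1 * exp 1 ≤ 9 := by nlinarith
    have h2 : 4 * √D ≤ 2 * √(2 * π * (n + D : ℕ)) := by
      rw [show (4 : ℝ) * √D = 2 * (√4 * √D) by
        rw [show (4 : ℝ) = 2 ^ 2 by norm_num, Real.sqrt_sq (by norm_num)]; ring,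
        ← Real.sqrt_mul (by norm_num)]
      refine mul_le_mul_of_nonneg_left (Real.sqrt_le_sqrt ?_) (by norm_num)
      push_cast
      nlinarith [pi_gt_three]
    have := Real.sqrt_nonneg (D : ℝ)
    nlinarith
  have hfac : (n.factorial * D.factorial : ℝ) ≤
      exp 1 * exp 1 * √D * √n * ((n / exp 1) ^ n * (D / exp 1) ^ D) := by
    calc (n.factorial * D.factorial : ℝ) ≤
        (exp 1 * √n * (n / exp 1) ^ n) * (exp 1 * √D * (D / exp 1) ^ D) := by gcongr
      _ = _ := by ring
  set s := √(2 * π * (n + D : ℕ)) with hs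
  have hs0 : 0 < s := by positivity
  have hmain : s * (((n + D : ℕ) : ℝ) / exp 1) ^ (n + D) ≤
      (n + D).choose n * (5 * s * √n * ((n / exp 1) ^ n * (D / exp 1) ^ D)) := by
    rw [← hchoose] at hlow
    refine hlow.trans (mul_le_mul_of_nonneg_left (hfac.trans ?_) (Nat.cast_nonneg _))
    gcongr
  rw [div_le_iff₀ (by positivity)]
  have hE : 0 < exp 1 ^ (n + D) := by positivity
  rw [div_pow, div_pow, div_pow, div_mul_div_comm, ← pow_add] at hmain
  have hmain' : s / exp 1 ^ (n + D) * ((n : ℝ) + D) ^ (n + D) ≤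
      s / exp 1 ^ (n + D) * (5 * √n * (n + D).choose n * (D ^ D * n ^ n)) := by
    push_cast at hmain
    calc _ = s * (((n : ℝ) + D) ^ (n + D) / exp 1 ^ (n + D)) := by ring
      _ ≤ _ := hmain
      _ = _ := by ring
  exact le_of_mul_le_mul_left hmain' (by positivity)

theorem pow_div_le_exp {n D : ℕ} (hD : D ≠ 0) (h : D ≤ n) :
    ((n : ℝ) + D) ^ (n + D) / (D ^ D * n ^ n) ≤ exp (2 * n) := by
  have hD0 : (0 : ℝ) < D := by positivity
  have hDn : (D : ℝ) ≤ n := by exact_mod_cast h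
  have hn0 : (0 : ℝ) < n := hD0.trans_le hDn
  have hbound : ∀ k : ℕ, (0 : ℝ) < k →
      (((n : ℝ) + D) / (2 * k)) ^ k ≤ exp (((n : ℝ) + D) / 2 - k) := by
    intro k hk
    calc (((n : ℝ) + D) / (2 * k)) ^ k ≤ exp (((n : ℝ) + D) / (2 * k) - 1) ^ k := by
          gcongr
          linarith [add_one_le_exp (((n : ℝ) + D) / (2 * k) - 1)]
      _ = _ := by
          rw [← exp_nat_mul]
          congr 1
          field_simp
  have hprod := mul_le_mul (hbound n hn0) (hbound D hD0) (by positivity) (by positivity)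
  rw [← exp_add, show ((n : ℝ) + D) / 2 - n + (((n : ℝ) + D) / 2 - D) = 0 by ring, exp_zero] at hprod
  have htwo : (2 : ℝ) ^ (n + D) ≤ exp (2 * n) := by
    calc (2 : ℝ) ^ (n + D) ≤ exp 1 ^ (n + D) := by
          gcongr
          linarith [add_one_le_exp (1 : ℝ)]
      _ = exp ((n + D : ℕ) * 1) := (exp_nat_mul _ _).symm
      _ ≤ _ := by
          rw [exp_le_exp]
          push_cast
          linarith
  calc ((n : ℝ) + D) ^ (n + D) / (D ^ D * n ^ n)
      = 2 ^ (n + D) * ((((n : ℝ) + D) / (2 * n)) ^ n * (((n : ℝ) + D) / (2 * D)) ^ D) := by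
        simp only [div_pow, mul_pow, pow_add]
        field_simp
    _ ≤ exp (2 * n) * 1 := by gcongr
    _ = _ := mul_one _

end Estimates

/-- For `1 ≤ D < n` there is a covering code for worst-case Kendall τ-distortion `D`
of size at most `64·n^(3/2)·n!·D^D·n^n / (n+D)^(n+D)`. -/
theorem stmt_11 (n D : ℕ) (hD : 1 ≤ D) (hDn : D < n) :
    ∃ C : Finset (Equiv.Perm (Fin n)),
      (C.card : ℝ) ≤ 64 * (n : ℝ) ^ ((3 : ℝ) / 2) * (n.factorial : ℝ) * (D : ℝ) ^ D *
        (n : ℝ) ^ n / ((n : ℝ) + (D : ℝ)) ^ (n + D) ∧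
      ∀ π : Equiv.Perm (Fin n), ∃ σ ∈ C, kendallDist π σ ≤ D := by
  have hSne : (adjacentBall n D).Nonempty := ⟨1, one_mem_adjacentBall n D⟩
  obtain ⟨C, hC, hcover⟩ := exists_cover (adjacentBall n D) hSne (2 * n) (by positivity)
  refine ⟨C, hC.trans ?_, fun π => ?_⟩
  · rw [Fintype.card_perm, Fintype.card_fin]
    have hD0 : (0 : ℝ) < D := by exact_mod_cast hD
    have hn1 : (1 : ℝ) ≤ n := by exact_mod_cast (by omega : 1 ≤ n)
    have hn0 : (0 : ℝ) < n := by linarith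
    set T : ℝ := ((n : ℝ) + D) ^ (n + D) / (D ^ D * n ^ n) with hT
    have hT0 : 0 < T := by positivity
    have hB0 : (0 : ℝ) < (adjacentBall n D).card := by exact_mod_cast hSne.card_pos
    have hs1 : 1 ≤ √(n : ℝ) := Real.one_le_sqrt.2 hn1
    have hball : T ≤ 20 * √n * (adjacentBall n D).card := by
      have h1 : T ≤ _ := pow_div_le_choose (by omega : n ≠ 0) (by omega : D ≠ 0)
      have h2 : ((n + D).choose n : ℝ) ≤ 4 * (adjacentBall n D).card := by
        exact_mod_cast choose_le_four_mul_card_adjacentBall hDn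
      calc T ≤ 5 * √n * (n + D).choose n := h1
        _ ≤ 5 * √n * (4 * (adjacentBall n D).card) := by gcongr
        _ = _ := by ring
    have hratio : (n.factorial : ℝ) / (adjacentBall n D).card ≤ 20 * √n * (n.factorial / T) := by
      rw [← mul_div_assoc, div_le_div_iff₀ hB0 hT0]
      nlinarith [mul_le_mul_of_nonneg_left hball (Nat.cast_nonneg (α := ℝ) n.factorial)]
    have hexp : Real.exp (-(2 * n)) ≤ 1 / T := by
      rw [Real.exp_neg, ← one_div]
      exact one_div_le_one_div_of_le hT0 (pow_div_le_exp (by omega) hDn.le)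
    have hpow : (n : ℝ) ^ ((3 : ℝ) / 2) = n * √n := by
      rw [show (3 : ℝ) / 2 = 1 + 1 / 2 by norm_num, Real.rpow_add hn0, Real.rpow_one,
        Real.sqrt_eq_rpow]
    have hns : √(n : ℝ) ≤ n * √n := le_mul_of_one_le_left (by positivity) hn1
    calc (2 * n + 1 : ℝ) * (n.factorial / (adjacentBall n D).card) +
          n.factorial * Real.exp (-(2 * n))
        ≤ (2 * n + 1 : ℝ) * (20 * √n * (n.factorial / T)) + n.factorial * (1 / T) := by gcongr
      _ = (40 * (n * √n) + 20 * √n + 1) * (n.factorial / T) := by ring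
      _ ≤ (64 * (n * √n)) * (n.factorial / T) := by
        gcongr
        linarith
      _ = _ := by
        rw [hpow, hT, div_div_eq_mul_div]
        ring
  · obtain ⟨σ, hσ, hmem⟩ := hcover π
    exact ⟨σ, hσ, kendallDist_le_of_mem_adjacentBall hmem⟩
end
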